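/- For every real number c > 0 there exists a positive integer d = d(c) such that the following holds. If G is a d-quasirandom finite group of order n, then every product-free subset of G has size strictly less than c·n. -/

import Mathlib

open Pointwise

/-- A subset `A` of a group is product-free if there are no `x, y, z ∈ A` with `x * y = z`. -/
def ProductFree {G : Type*} [Group G] (A : Set G) : Prop :=
  ∀ x ∈ A, ∀ y ∈ A, x * y ∉ A

/-- A group `G` is `d`-quasirandom if every homomorphism from `G` into a complex unitary
group `U_m(ℂ)` with `m < d` is trivial. -/
def IsQuasirandom (d : ℕ) (G : Type*) [Group G] : Prop :=
  ∀ m : ℕ, m < d → ∀ f : G →* Matrix.unitaryGroup (Fin m) ℂ, ∀ g : G, f g = 1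

open scoped InnerProductSpace

/-- An isometric representation of dimension less than `d` of a `d`-quasirandom group is trivial. -/
lemma IsQuasirandom.apply_eq_one_of_isometric {d : ℕ} {G : Type*} [Group G]
    (hG : IsQuasirandom d G) {V : Type*} [NormedAddCommGroup V] [InnerProductSpace ℂ V]
    [FiniteDimensional ℂ V] (R : G →* (V →ₗ[ℂ] V))
    (hR : ∀ g v w, ⟪R g v, R g w⟫_ℂ = ⟪v, w⟫_ℂ) (hd : Module.finrank ℂ V < d) (g : G) :
    R g = 1 := by
  let φ := LinearMap.toMatrixOrthonormal (stdOrthonormalBasis ℂ V)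
  let F : G →* Matrix (Fin (Module.finrank ℂ V)) (Fin (Module.finrank ℂ V)) ℂ :=
    (φ : (V →ₗ[ℂ] V) →* _).comp R
  have hF : ∀ g, F g ∈ Matrix.unitaryGroup (Fin (Module.finrank ℂ V)) ℂ := by
    intro g
    rw [Matrix.mem_unitaryGroup_iff']
    have h1 : star (R g) * R g = 1 := by
      ext v
      refine ext_inner_left ℂ fun w => ?_
      rw [LinearMap.star_eq_adjoint, Module.End.mul_apply, LinearMap.adjoint_inner_right, hR]
      rfl
    change star (φ (R g)) * φ (R g) = 1
    rw [← map_star, ← map_mul, h1, map_one]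
  have h := hG _ hd (F.codRestrict _ hF) g
  have h2 : φ (R g) = 1 := congrArg Subtype.val h
  exact φ.injective (h2.trans (map_one φ).symm)

/-- If a linear map commutes with an isometric action of a `d`-quasirandom group, kills the
invariant vectors and has squared Hilbert-Schmidt norm at most `K`, then its squared operator norm
is at most `K / d`. -/
lemma IsQuasirandom.mul_norm_sq_le {d : ℕ} {G : Type*} [Group G]
    (hG : IsQuasirandom d G) {V : Type*} [NormedAddCommGroup V] [InnerProductSpace ℂ V]
    [FiniteDimensional ℂ V] (R : G →* (V →ₗ[ℂ] V))
    (hR : ∀ g v w, ⟪R g v, R g w⟫_ℂ = ⟪v, w⟫_ℂ) (T : V →ₗ[ℂ] V)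
    (hT : ∀ g v, T (R g v) = R g (T v)) (hinv : ∀ v, (∀ g, R g v = v) → T v = 0) {K : ℝ}
    (hK : ∀ (m : ℕ) (b : Fin m → V), Orthonormal ℂ b → ∑ i, ‖T (b i)‖ ^ 2 ≤ K) (v : V) :
    d * ‖T v‖ ^ 2 ≤ K * ‖v‖ ^ 2 := by
  have hK0 : 0 ≤ K := by simpa using hK 0 Fin.elim0 ⟨fun i => i.elim0, fun i => i.elim0⟩
  rcases eq_or_ne v 0 with rfl | hv
  · simp
  have : Nontrivial V := ⟨v, 0, hv⟩
  set S : V →ₗ[ℂ] V := LinearMap.adjoint T ∘ₗ T with hS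
  have hSinner : ∀ x y, ⟪S x, y⟫_ℂ = ⟪T x, T y⟫_ℂ := fun x y => by
    rw [hS, LinearMap.comp_apply, LinearMap.adjoint_inner_left]
  have hsymm : S.IsSymmetric := fun x y => by
    rw [hSinner, ← inner_conj_symm x, hSinner, inner_conj_symm]
  have hre : ∀ x, RCLike.re ⟪S x, x⟫_ℂ = ‖T x‖ ^ 2 := fun x => by
    rw [hSinner, inner_self_eq_norm_sq]
  set L : ℝ := ⨆ x : { x : V // x ≠ 0 }, RCLike.re ⟪S x, x⟫_ℂ / ‖(x : V)‖ ^ 2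
  have hbdd : BddAbove (Set.range fun x : { x : V // x ≠ 0 } =>
      RCLike.re ⟪S x, x⟫_ℂ / ‖(x : V)‖ ^ 2) := by
    refine ⟨‖LinearMap.toContinuousLinearMap T‖ ^ 2, ?_⟩
    rintro _ ⟨⟨x, hx⟩, rfl⟩
    have := (LinearMap.toContinuousLinearMap T).le_opNorm x
    have hx' : 0 < ‖x‖ := norm_pos_iff.2 hx
    simp only [hre]
    rw [div_le_iff₀ (by positivity), ← mul_pow]
    exact pow_le_pow_left₀ (norm_nonneg _) this 2
  have hle : ‖T v‖ ^ 2 ≤ L * ‖v‖ ^ 2 := by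
    have hv' : 0 < ‖v‖ := norm_pos_iff.2 hv
    have : RCLike.re ⟪S v, v⟫_ℂ / ‖v‖ ^ 2 ≤ L := le_ciSup hbdd ⟨v, hv⟩
    rwa [hre, div_le_iff₀ (by positivity)] at this
  have heig : Module.End.HasEigenvalue S (L : ℂ) :=
    hsymm.hasEigenvalue_iSup_of_finiteDimensional
  suffices hdL : d * L ≤ K by
    calc d * ‖T v‖ ^ 2 ≤ d * (L * ‖v‖ ^ 2) := by gcongr
      _ = d * L * ‖v‖ ^ 2 := by ring
      _ ≤ K * ‖v‖ ^ 2 := by gcongr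
  rcases le_or_gt L 0 with hL0 | hL0
  · exact (mul_nonpos_of_nonneg_of_nonpos (Nat.cast_nonneg d) hL0).trans hK0
  set E := Module.End.eigenspace S (L : ℂ)
  have hcomm : ∀ g x, S (R g x) = R g (S x) := by
    intro g x
    refine ext_inner_right ℂ fun y => ?_
    have hy : R g (R g⁻¹ y) = y := by
      rw [← Module.End.mul_apply, ← map_mul, mul_inv_cancel, map_one, Module.End.one_apply]
    rw [hSinner, hT, ← hy, hT, hR, hR, hSinner]
  have hE : ∀ g, ∀ x ∈ E, R g x ∈ E := by
    intro g x hx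
    rw [Module.End.mem_eigenspace_iff] at hx ⊢
    rw [hcomm, hx, map_smul]
  let RE : G →* (E →ₗ[ℂ] E) :=
    { toFun := fun g => (R g).restrict (hE g)
      map_one' := by ext x; simp
      map_mul' := fun g h => by ext x; simp }
  have hdim : d ≤ Module.finrank ℂ E := by
    by_contra! hlt
    obtain ⟨x, hx, hx0⟩ := heig.exists_hasEigenvector
    have hfix : ∀ g, R g x = x := fun g => by
      have := hG.apply_eq_one_of_isometric RE (fun g v w => hR g v w) hlt g
      exact congrArg Subtype.val (LinearMap.congr_fun this ⟨x, hx⟩)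
    have h0 : S x = 0 := by rw [hS, LinearMap.comp_apply, hinv x hfix, map_zero]
    rw [Module.End.mem_eigenspace_iff.1 hx] at h0
    rcases smul_eq_zero.1 h0 with h | h
    · exact hL0.ne' (by exact_mod_cast h)
    · exact hx0 h
  have hbK := hK _ (fun i => (stdOrthonormalBasis ℂ E i : V))
    ((stdOrthonormalBasis ℂ E).orthonormal.comp_linearIsometry E.subtypeₗᵢ)
  have hb : ∀ i, ‖T (stdOrthonormalBasis ℂ E i : V)‖ ^ 2 = L := by
    intro i
    have h1 : ‖(stdOrthonormalBasis ℂ E i : V)‖ = 1 := (stdOrthonormalBasis ℂ E).orthonormal.1 i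
    rw [← hre, Module.End.mem_eigenspace_iff.1 (stdOrthonormalBasis ℂ E i).2, inner_smul_left,
      inner_self_eq_norm_sq_to_K, h1]
    simp
  simp only [hb, Finset.sum_const, Finset.card_univ, Fintype.card_fin, nsmul_eq_mul] at hbK
  exact le_trans (by gcongr) hbK

/-- The right regular representation on `ℓ²(G)`. -/
noncomputable def rightRegular (G : Type*) [Group G] [Fintype G] :
    G →* (EuclideanSpace ℂ G →ₗ[ℂ] EuclideanSpace ℂ G) where
  toFun g :=
    { toFun := fun v => WithLp.toLp 2 fun x => v (x * g)
      map_add' := fun v w => by ext; simp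
      map_smul' := fun a v => by ext; simp }
  map_one' := by ext; simp
  map_mul' g h := by ext; simp [mul_assoc]

/-- Left convolution with a function `f` on `ℓ²(G)`. -/
noncomputable def leftConvolution {G : Type*} [Group G] [Fintype G] (f : G → ℝ) :
    EuclideanSpace ℂ G →ₗ[ℂ] EuclideanSpace ℂ G where
  toFun v := WithLp.toLp 2 fun x => ∑ y, (f (x * y⁻¹) : ℂ) * v y
  map_add' v w := by ext; simp [mul_add, Finset.sum_add_distrib]
  map_smul' a v := by ext; simp [Finset.mul_sum, mul_left_comm]

lemma rightRegular_apply {G : Type*} [Group G] [Fintype G] (g : G) (v : EuclideanSpace ℂ G)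
    (x : G) : rightRegular G g v x = v (x * g) := rfl

lemma leftConvolution_apply {G : Type*} [Group G] [Fintype G] (f : G → ℝ)
    (v : EuclideanSpace ℂ G) (x : G) :
    leftConvolution f v x = ∑ y, (f (x * y⁻¹) : ℂ) * v y := rfl

lemma inner_rightRegular {G : Type*} [Group G] [Fintype G] (g : G) (v w : EuclideanSpace ℂ G) :
    ⟪rightRegular G g v, rightRegular G g w⟫_ℂ = ⟪v, w⟫_ℂ := by
  simp only [PiLp.inner_apply, rightRegular_apply]
  exact Equiv.sum_comp (Equiv.mulRight g) fun x => ⟪v x, w x⟫_ℂ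

lemma leftConvolution_rightRegular {G : Type*} [Group G] [Fintype G] (f : G → ℝ) (g : G)
    (v : EuclideanSpace ℂ G) :
    leftConvolution f (rightRegular G g v) = rightRegular G g (leftConvolution f v) := by
  ext x
  simp only [leftConvolution_apply, rightRegular_apply]
  rw [← Equiv.sum_comp (Equiv.mulRight g) fun y => (f (x * g * y⁻¹) : ℂ) * v y]
  simp [mul_assoc]

/-- The squared Hilbert-Schmidt norm of convolution with a function bounded by `1` is at most
`|G| ^ 2`. -/
lemma sum_norm_leftConvolution_sq_le {G : Type*} [Group G] [Fintype G] {f : G → ℝ}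
    (hf : ∀ x, |f x| ≤ 1) (m : ℕ) (b : Fin m → EuclideanSpace ℂ G) (hb : Orthonormal ℂ b) :
    ∑ i, ‖leftConvolution f (b i)‖ ^ 2 ≤ (Fintype.card G : ℝ) ^ 2 := by
  let r : G → EuclideanSpace ℂ G := fun x => WithLp.toLp 2 fun y => (f (x * y⁻¹) : ℂ)
  have hr : ∀ x v, leftConvolution f v x = ⟪r x, v⟫_ℂ := fun x v => by
    simp [leftConvolution_apply, PiLp.inner_apply, r, mul_comm]
  have hrn : ∀ x, ‖r x‖ ^ 2 ≤ Fintype.card G := fun x => by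
    rw [EuclideanSpace.norm_sq_eq]
    refine (Finset.sum_le_card_nsmul _ _ 1 fun y _ => ?_).trans (by simp)
    simpa [r] using hf (x * y⁻¹)
  calc ∑ i, ‖leftConvolution f (b i)‖ ^ 2 = ∑ x, ∑ i, ‖⟪b i, r x⟫_ℂ‖ ^ 2 := by
        rw [Finset.sum_comm]
        refine Finset.sum_congr rfl fun i _ => ?_
        rw [EuclideanSpace.norm_sq_eq]
        exact Finset.sum_congr rfl fun x _ => by rw [hr, norm_inner_symm]
    _ ≤ ∑ x : G, (Fintype.card G : ℝ) :=
        Finset.sum_le_sum fun x _ => (hb.sum_inner_products_le (r x)).trans (hrn x)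
    _ = (Fintype.card G : ℝ) ^ 2 := by simp [sq]

/-- Convolution with a mean-zero function kills the invariant vectors. -/
lemma leftConvolution_eq_zero {G : Type*} [Group G] [Fintype G] {f : G → ℝ} (hf : ∑ x, f x = 0)
    (v : EuclideanSpace ℂ G) (hv : ∀ g, rightRegular G g v = v) : leftConvolution f v = 0 := by
  have hv1 : ∀ y, v y = v 1 := fun y => by
    conv_rhs => rw [← hv y]
    rw [rightRegular_apply, one_mul]
  ext x
  rw [leftConvolution_apply]
  have : ∑ y, f (x * y⁻¹) = 0 := by
    rw [← hf]
    exact Equiv.sum_comp ((Equiv.inv G).trans (Equiv.mulLeft x)) f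
  simp only [hv1, ← Finset.sum_mul, ← Complex.ofReal_sum, this]
  simp

/-- Gowers' bound on the density of a product-free set in a quasirandom group. -/
lemma IsQuasirandom.mul_ncard_pow_four_le {d : ℕ} {G : Type*} [Group G] [Fintype G]
    (hG : IsQuasirandom d G) {A : Set G} (hA : ProductFree A) :
    d * (A.ncard : ℝ) ^ 4 ≤ (Fintype.card G : ℝ) ^ 4 := by
  classical
  set n : ℝ := (Fintype.card G : ℝ) with hn
  set a : ℝ := (A.ncard : ℝ) with ha
  have hn0 : 0 < n := by rw [hn]; exact_mod_cast Fintype.card_pos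
  have ha0 : 0 ≤ a := by positivity
  have han : a ≤ n := by
    rw [ha, hn, ← Nat.card_eq_fintype_card]
    exact_mod_cast Set.ncard_le_card A
  rcases ha0.eq_or_lt with h0 | hapos
  · rw [← h0]; simp; positivity
  have hsum : ∑ x, A.indicator (1 : G → ℝ) x = a := by
    rw [ha, Set.ncard_eq_toFinset_card', ← Set.filter_mem_univ_eq_toFinset]
    simp only [Set.indicator_apply, Pi.one_apply, Finset.sum_boole]
  let f : G → ℝ := fun x => A.indicator 1 x - a / n
  have hf0 : ∑ x, f x = 0 := by
    simp only [f, Finset.sum_sub_distrib, hsum, Finset.sum_const, Finset.card_univ, nsmul_eq_mul]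
    rw [← hn]
    field_simp
    ring
  have hf1 : ∀ x, |f x| ≤ 1 := fun x => by
    have h1 : a / n ≤ 1 := (div_le_one hn0).2 han
    have h2 : 0 ≤ a / n := by positivity
    by_cases hx : x ∈ A <;> simp only [f, hx, Set.indicator_of_mem, Set.indicator_of_notMem,
      not_false_eq_true, Pi.one_apply] <;> rw [abs_le] <;> constructor <;> linarith
  let v : EuclideanSpace ℂ G := WithLp.toLp 2 fun x => ((A.indicator 1 x : ℝ) : ℂ)
  have hvn : ‖v‖ ^ 2 = a := by
    rw [EuclideanSpace.norm_sq_eq, ← hsum]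
    refine Finset.sum_congr rfl fun x _ => ?_
    by_cases hx : x ∈ A <;> simp [v, hx]
  have hmain := hG.mul_norm_sq_le (rightRegular G) inner_rightRegular (leftConvolution f)
    (leftConvolution_rightRegular f) (leftConvolution_eq_zero hf0)
    (sum_norm_leftConvolution_sq_le hf1) v
  have hinner : ⟪v, leftConvolution f v⟫_ℂ = ((-(a / n * a ^ 2) : ℝ) : ℂ) := by
    have h1 : ∀ x y, A.indicator (1 : G → ℝ) x * (f (x * y⁻¹) * A.indicator 1 y) =
        -(a / n) * (A.indicator 1 x * A.indicator 1 y) := by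
      intro x y
      by_cases hx : x ∈ A <;> by_cases hy : y ∈ A <;> simp [hx, hy, f]
      intro hxy
      exact hA _ hxy _ hy (by simpa using hx)
    have h2 : ⟪v, leftConvolution f v⟫_ℂ =
        ((∑ x, ∑ y, A.indicator (1 : G → ℝ) x * (f (x * y⁻¹) * A.indicator 1 y) : ℝ) : ℂ) := by
      rw [PiLp.inner_apply]
      push_cast
      refine Finset.sum_congr rfl fun x _ => ?_
      rw [leftConvolution_apply, ← Finset.mul_sum]
      simp [v, mul_comm]
    rw [h2]
    simp only [h1, ← Finset.mul_sum, ← Finset.sum_mul, hsum]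
    congr 1
    ring
  have hcs := norm_inner_le_norm (𝕜 := ℂ) v (leftConvolution f v)
  rw [hinner, Complex.norm_real, norm_neg, Real.norm_of_nonneg (by positivity)] at hcs
  have hcs2 : (a / n * a ^ 2) ^ 2 ≤ a * ‖leftConvolution f v‖ ^ 2 := by
    rw [← hvn, ← mul_pow, hvn]
    exact pow_le_pow_left₀ (by positivity) hcs 2
  rw [hvn] at hmain
  have h3 : d * (a / n * a ^ 2) ^ 2 ≤ n ^ 2 * a ^ 2 := by
    calc d * (a / n * a ^ 2) ^ 2 ≤ d * (a * ‖leftConvolution f v‖ ^ 2) := by gcongr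
      _ = a * (d * ‖leftConvolution f v‖ ^ 2) := by ring
      _ ≤ a * (n ^ 2 * a) := by gcongr
      _ = n ^ 2 * a ^ 2 := by ring
  have h4 : d * (a / n * a ^ 2) ^ 2 = d * a ^ 4 * (a ^ 2 / n ^ 2) := by ring
  have h5 : n ^ 2 * a ^ 2 = n ^ 4 * (a ^ 2 / n ^ 2) := by field_simp
  rw [h4, h5] at h3
  exact le_of_mul_le_mul_right h3 (by positivity)

theorem stmt_12 (c : ℝ) (hc : 0 < c) :
    ∃ d : ℕ, 0 < d ∧
      ∀ (G : Type) [Group G] [Fintype G],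
        IsQuasirandom d G →
        ∀ A : Set G, ProductFree A → (A.ncard : ℝ) < c * (Fintype.card G : ℝ) := by
  obtain ⟨d, hd⟩ := exists_nat_gt (1 / c ^ 4)
  have hd0 : (0 : ℝ) < d := lt_trans (by positivity) hd
  refine ⟨d, by exact_mod_cast hd0, fun G _ _ hG A hA => ?_⟩
  by_contra! hle
  have hn : (0 : ℝ) < Fintype.card G := by exact_mod_cast Fintype.card_pos
  have h := hG.mul_ncard_pow_four_le hA
  have h1 : (c * (Fintype.card G : ℝ)) ^ 4 ≤ (A.ncard : ℝ) ^ 4 := by gcongr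
  rw [div_lt_iff₀ (by positivity)] at hd
  have h2 : (1 : ℝ) * (Fintype.card G : ℝ) ^ 4 < d * c ^ 4 * (Fintype.card G : ℝ) ^ 4 := by gcongr
  have h3 : d * (c * (Fintype.card G : ℝ)) ^ 4 ≤ d * (A.ncard : ℝ) ^ 4 := by gcongr
  rw [mul_pow] at h3
  linarith
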